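/- Every derivation δ of a C*-algebra A whose domain of definition is all of A is a bounded linear operator. -/

import Mathlib

open Filter Topology in
/-- Self-adjoint elements whose norm lies in the spectrum. -/
theorem aux_pos {A : Type*} [CStarAlgebra A] [PartialOrder A] [StarOrderedRing A]
    (δ : A →ₗ[ℂ] A)
    (hLeib : ∀ a b : A, δ (a * b) = δ a * b + a * δ b)
    (hstar : ∀ a : A, δ (star a) = star (δ a)) (a : A) (ha : IsSelfAdjoint a)
    (hs : ‖a‖ ∈ spectrum ℝ a) : ‖a‖ ≤ ‖a + δ a‖ := by
  by_contra! hlt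
  have hδ1 : δ 1 = 0 := by
    have := hLeib 1 1
    simpa using this
  have hδr : ∀ r : ℝ, δ (algebraMap ℝ A r) = 0 := by
    intro r
    rw [IsScalarTower.algebraMap_apply ℝ ℂ A, Algebra.algebraMap_eq_smul_one, map_smul, hδ1,
      smul_zero]
  have hsa : ∀ x : A, IsSelfAdjoint x → IsSelfAdjoint (δ x) := by
    intro x hx
    rw [IsSelfAdjoint, ← hstar, hx.star_eq]
  have hb : 0 ≤ algebraMap ℝ A ‖a‖ - a := sub_nonneg.2 ha.le_algebraMap_norm_self
  obtain ⟨h, hh0, hh⟩ : ∃ h : A, 0 ≤ h ∧ h * h = algebraMap ℝ A ‖a‖ - a :=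
    ⟨CFC.sqrt _, CFC.sqrt_nonneg _, CFC.sqrt_mul_sqrt_self _ hb⟩
  have hhsa : IsSelfAdjoint h := .of_nonneg hh0
  have hnu : ¬ IsUnit (h * h) := by rw [hh]; exact hs
  obtain ⟨k, hk⟩ : ∃ k, k = δ h := ⟨_, rfl⟩
  have hksa : IsSelfAdjoint k := hk ▸ hsa h hhsa
  have hδa : δ a = -(k * h + h * k) := by
    have h1 := hLeib h h
    rw [hh, map_sub, hδr, ← hk] at h1
    rw [← h1]; simp
  obtain ⟨ε, hε⟩ : ∃ ε, ε = ‖a‖ - ‖a + δ a‖ := ⟨_, rfl⟩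
  have hε0 : 0 < ε := by linarith
  have hle : algebraMap ℝ A ε ≤ h * h + (k * h + h * k) := by
    have h1 := (ha.add (hsa a ha)).le_algebraMap_norm_self
    rw [hε, map_sub, hh, ← neg_eq_iff_eq_neg.2 hδa]
    rw [← sub_nonneg] at h1 ⊢
    convert h1 using 1
    abel
  obtain ⟨s, hsdef⟩ : ∃ s, s = ε / (2 * (‖k‖ ^ 2 + 1)) := ⟨_, rfl⟩
  have hs0 : 0 < s := by rw [hsdef]; positivity
  have hsk : s * ‖k‖ ^ 2 ≤ ε / 2 := by
    have : s * (‖k‖ ^ 2 + 1) = ε / 2 := by rw [hsdef]; field_simp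
    nlinarith
  have hkk : k * k ≤ algebraMap ℝ A (‖k‖ ^ 2) := by
    have := CStarAlgebra.star_mul_le_algebraMap_norm_sq (a := k)
    rwa [hksa.star_eq] at this
  have hsq : 0 ≤ (s • k - h) * (s • k - h) := by
    have h1 : IsSelfAdjoint (s • k - h) := ((IsSelfAdjoint.all s).smul hksa).sub hhsa
    have := star_mul_self_nonneg (s • k - h)
    rwa [h1.star_eq] at this
  have key : algebraMap ℝ A (s * ε / 2) ≤ (1 + s) • (h * h) := by
    have e1 : 0 ≤ s • (h * h + (k * h + h * k) - algebraMap ℝ A ε) :=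
      smul_nonneg hs0.le (sub_nonneg.2 hle)
    have e2 : 0 ≤ (s ^ 2) • (algebraMap ℝ A (‖k‖ ^ 2) - k * k) :=
      smul_nonneg (by positivity) (sub_nonneg.2 hkk)
    have e3 : 0 ≤ algebraMap ℝ A (s * (ε / 2 - s * ‖k‖ ^ 2)) :=
      algebraMap_nonneg A (mul_nonneg hs0.le (sub_nonneg.2 hsk))
    rw [← sub_nonneg]
    convert add_nonneg (add_nonneg (add_nonneg e1 e2) e3) hsq using 1
    simp only [Algebra.algebraMap_eq_smul_one, mul_sub, sub_mul, smul_mul_assoc, mul_smul_comm]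
    module
  have hu := CStarAlgebra.isUnit_of_le _ key
    (IsStrictlyPositive.iff_of_unital.2 ⟨algebraMap_nonneg A (by positivity),
      (IsUnit.mk0 _ (by positivity : s * ε / 2 ≠ 0)).map _⟩)
  apply hnu
  have h1 : IsUnit (1 + s) := IsUnit.mk0 _ (by positivity)
  exact (isUnit_smul_iff h1.unit (h * h)).1 hu

theorem aux_norm {A : Type*} [CStarAlgebra A] [PartialOrder A] [StarOrderedRing A]
    (δ : A →ₗ[ℂ] A)
    (hLeib : ∀ a b : A, δ (a * b) = δ a * b + a * δ b)
    (hstar : ∀ a : A, δ (star a) = star (δ a)) (a : A) (ha : IsSelfAdjoint a) :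
    ‖a‖ ≤ ‖a + δ a‖ := by
  nontriviality A
  rcases CStarAlgebra.norm_or_neg_norm_mem_spectrum ha with h | h
  · exact aux_pos δ hLeib hstar a ha h
  · have := aux_pos δ hLeib hstar (-a) ha.neg (by
      rw [norm_neg, ← spectrum.neg_eq]; simpa using h)
    rwa [map_neg, ← neg_add, norm_neg, norm_neg] at this

open Filter Topology in
theorem aux_closable {A : Type*} [CStarAlgebra A] [PartialOrder A] [StarOrderedRing A]
    (δ : A →ₗ[ℂ] A)
    (hLeib : ∀ a b : A, δ (a * b) = δ a * b + a * δ b)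
    (hstar : ∀ a : A, δ (star a) = star (δ a)) (v : ℕ → A) (hv : ∀ n, IsSelfAdjoint (v n))
    (b : A) (h0 : Tendsto v atTop (𝓝 0)) (hb : Tendsto (fun n => δ (v n)) atTop (𝓝 b)) :
    b = 0 := by
  have hbsa : IsSelfAdjoint b := by
    refine tendsto_nhds_unique (hb.star) (hb.congr fun n => ?_)
    rw [← hstar, (hv n).star_eq]
  have key : ∀ r : ℝ, 0 < r → ‖b‖ ≤ r * ‖δ b‖ := by
    intro r hr
    have h1 : ∀ n, ‖-((r : ℂ) • b) + v n‖ ≤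
        ‖-((r : ℂ) • b) + v n + (r : ℂ) • (-((r : ℂ) • δ b) + δ (v n))‖ := by
      intro n
      have hr' : IsSelfAdjoint (r : ℂ) := Complex.conj_ofReal r
      have := aux_norm ((r : ℂ) • δ) (fun a b => by simp [hLeib])
        (fun a => by simp [hstar]) (-((r : ℂ) • b) + v n) ((hr'.smul hbsa).neg.add (hv n))
      simpa using this
    have h2 := le_of_tendsto_of_tendsto'
      ((tendsto_const_nhds (x := -((r : ℂ) • b))).add h0).norm
      (((tendsto_const_nhds (x := -((r : ℂ) • b))).add h0).add
        (((tendsto_const_nhds (x := -((r : ℂ) • δ b))).add hb).const_smul (r : ℂ))).norm h1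
    have h3 : -((r : ℂ) • b) + 0 + (r : ℂ) • (-((r : ℂ) • δ b) + b)
        = -((r : ℂ) • (r : ℂ) • δ b) := by module
    rw [h3, add_zero, norm_neg, norm_neg, norm_smul, norm_smul, norm_smul, Complex.norm_real,
      Real.norm_of_nonneg hr.le] at h2
    exact le_of_mul_le_mul_left h2 hr
  by_contra hne
  have hpos : 0 < ‖b‖ := norm_pos_iff.2 hne
  have := key (‖b‖ / (2 * (‖δ b‖ + 1))) (by positivity)
  rw [div_mul_eq_mul_div, le_div_iff₀ (by positivity)] at this
  nlinarith [norm_nonneg (δ b), mul_nonneg hpos.le (norm_nonneg (δ b))]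

open Filter Topology in
/-- Every everywhere-defined derivation of a C*-algebra is bounded. -/
theorem everywhere_defined_derivation_bounded
    (A : Type*) [NormedRing A] [StarRing A] [CStarRing A]
    [NormedAlgebra ℂ A] [CompleteSpace A] [StarModule ℂ A]
    (δ : A →ₗ[ℂ] A)
    (hLeib : ∀ a b : A, δ (a * b) = δ a * b + a * δ b)
    (hstar : ∀ a : A, δ (star a) = star (δ a)) :
    ∃ C : ℝ, ∀ a : A, ‖δ a‖ ≤ C * ‖a‖ := by
  let : CStarAlgebra A := {}
  let _ := CStarAlgebra.spectralOrder A
  have := CStarAlgebra.spectralOrderedRing A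
  have hc : Continuous δ := by
    refine δ.continuous_of_seq_closed_graph fun u x y hu hy => ?_
    have hre : ∀ (w : ℕ → A) (b : A), Tendsto w atTop (𝓝 0) →
        Tendsto (fun n => δ (w n)) atTop (𝓝 b) → b + star b = 0 := by
      intro w b hw hb
      refine aux_closable δ hLeib hstar (fun n => w n + star (w n))
        (fun n => IsSelfAdjoint.add_star_self _) _ ?_ ?_
      · simpa using hw.add hw.star
      · simpa [hstar] using hb.add hb.star
    have hv : Tendsto (fun n => u n - x) atTop (𝓝 0) := by
      simpa using hu.sub_const x
    have hd : Tendsto (fun n => δ (u n - x)) atTop (𝓝 (y - δ x)) := by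
      simpa using hy.sub_const (δ x)
    have e1 := hre _ _ hv hd
    have e2 := hre (fun n => Complex.I • (u n - x)) (Complex.I • (y - δ x))
      (by simpa using hv.const_smul Complex.I)
      (by simpa only [map_smul] using hd.const_smul Complex.I)
    rw [← sub_eq_zero]
    generalize y - δ x = b at e1 e2
    rw [star_smul, eq_neg_of_add_eq_zero_right e1] at e2
    have e3 : (2 * Complex.I) • b = 0 := by
      rw [← e2]
      simp [mul_smul, two_smul]
    simpa using e3
  exact ⟨‖(⟨δ, hc⟩ : A →L[ℂ] A)‖, fun a => (⟨δ, hc⟩ : A →L[ℂ] A).le_opNorm a⟩
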